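/- Consider the linearized data-center problem (p1) with B having nonnegative entries and a > 0. If (v, ρ) is feasible for (p1) with ρ ∈ {0,1}^n and Σ_{i=1}^n ρ_i ≥ D, then there exists ρ' ∈ {0,1}^n with ρ'_i ≤ ρ_i for all i and Σ_{i=1}^n ρ'_i = D such that (v, ρ') also satisfies all constraints of (p1). Consequently, the optimal value of (p1) is unchanged if the performance constraint Σ_i ρ_i ≥ D is replaced by the equality Σ_i ρ_i = D; i.e., the performance constraint is tight at some optimal solution. -/

import Mathlib

/-- A `0`-`1` vector whose entries sum to at least `D` dominates a `0`-`1` vector whose entries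
sum to exactly `D`. -/
theorem exists_zero_one_le_sum_eq {ι : Type*} [Fintype ι] (D : ℕ) (ρ : ι → ℝ)
    (h01 : ∀ i, ρ i = 0 ∨ ρ i = 1) (hsum : (D : ℝ) ≤ ∑ i, ρ i) :
    ∃ ρ' : ι → ℝ, (∀ i, ρ' i = 0 ∨ ρ' i = 1) ∧ (∀ i, ρ' i ≤ ρ i) ∧ ∑ i, ρ' i = (D : ℝ) := by
  classical
  have hcard : ∑ i, ρ i = ((Finset.univ.filter fun i => ρ i = 1).card : ℝ) := by
    rw [← Finset.sum_boole]
    refine Finset.sum_congr rfl fun i _ => ?_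
    rcases h01 i with h | h <;> simp [h]
  rw [hcard, Nat.cast_le] at hsum
  obtain ⟨t, ht, rfl⟩ := Finset.exists_subset_card_eq hsum
  refine ⟨fun i => if i ∈ t then 1 else 0, fun i => ?_, fun i => ?_, by simp⟩
  · by_cases hi : i ∈ t <;> simp [hi]
  · by_cases hi : i ∈ t
    · simp [hi, (Finset.mem_filter.mp (ht hi)).2]
    · rcases h01 i with h | h <;> simp [hi, h]

/-- in problem (p1), any integral feasible pair (v, ρ) with
Σρ ≥ D can be turned into a feasible pair (v, ρ') with ρ' ≤ ρ and Σρ' = D;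
consequently the sets of achievable costs with "≥ D" and with "= D" coincide,
i.e. the performance constraint is tight at some optimal solution. -/
theorem stmt_5
    (n m D : ℕ) (hn : 0 < n) (hm : 0 < m) (hD1 : 1 ≤ D) (hDn : D ≤ n)
    (A : Matrix (Fin n) (Fin m) ℝ) (hA : ∀ l j, 0 ≤ A l j)
    (B : Matrix (Fin n) (Fin n) ℝ) (hB : ∀ l i, 0 ≤ B l i)
    (E : Fin n → ℝ) (a b : ℝ) (ha : 0 < a)
    (VLB VUB : Fin m → EReal) :
    (∀ (v : Fin m → ℝ) (ρ : Fin n → ℝ),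
      (∀ i, ρ i = 0 ∨ ρ i = 1) → (∑ i, ρ i ≥ (D : ℝ)) →
      (∀ l, -∑ j, A l j * v j + ∑ i, B l i * ρ i + a * ρ l ≤ b - E l) →
      (∀ j, VLB j ≤ (v j : EReal) ∧ (v j : EReal) ≤ VUB j) →
      ∃ ρ' : Fin n → ℝ, (∀ i, ρ' i = 0 ∨ ρ' i = 1) ∧ (∀ i, ρ' i ≤ ρ i) ∧
        (∑ i, ρ' i = (D : ℝ)) ∧
        (∀ l, -∑ j, A l j * v j + ∑ i, B l i * ρ' i + a * ρ' l ≤ b - E l)) ∧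
    ({c : ℝ | ∃ (v : Fin m → ℝ) (ρ : Fin n → ℝ),
        (∀ i, ρ i = 0 ∨ ρ i = 1) ∧ (∑ i, ρ i ≥ (D : ℝ)) ∧
        (∀ l, -∑ j, A l j * v j + ∑ i, B l i * ρ i + a * ρ l ≤ b - E l) ∧
        (∀ j, VLB j ≤ (v j : EReal) ∧ (v j : EReal) ≤ VUB j) ∧
        c = ∑ j, v j}
      = {c : ℝ | ∃ (v : Fin m → ℝ) (ρ : Fin n → ℝ),
        (∀ i, ρ i = 0 ∨ ρ i = 1) ∧ (∑ i, ρ i = (D : ℝ)) ∧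
        (∀ l, -∑ j, A l j * v j + ∑ i, B l i * ρ i + a * ρ l ≤ b - E l) ∧
        (∀ j, VLB j ≤ (v j : EReal) ∧ (v j : EReal) ≤ VUB j) ∧
        c = ∑ j, v j}) := by
  have tighten : ∀ (v : Fin m → ℝ) (ρ : Fin n → ℝ),
      (∀ i, ρ i = 0 ∨ ρ i = 1) → (∑ i, ρ i ≥ (D : ℝ)) →
      (∀ l, -∑ j, A l j * v j + ∑ i, B l i * ρ i + a * ρ l ≤ b - E l) →
      ∃ ρ' : Fin n → ℝ, (∀ i, ρ' i = 0 ∨ ρ' i = 1) ∧ (∀ i, ρ' i ≤ ρ i) ∧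
        (∑ i, ρ' i = (D : ℝ)) ∧
        (∀ l, -∑ j, A l j * v j + ∑ i, B l i * ρ' i + a * ρ' l ≤ b - E l) := by
    intro v ρ h01 hsum hcons
    obtain ⟨ρ', h01', hle, hsum'⟩ := exists_zero_one_le_sum_eq D ρ h01 hsum
    refine ⟨ρ', h01', hle, hsum', fun l => le_trans ?_ (hcons l)⟩
    have hBl : ∑ i, B l i * ρ' i ≤ ∑ i, B l i * ρ i :=
      Finset.sum_le_sum fun i _ => mul_le_mul_of_nonneg_left (hle i) (hB l i)
    have hal : a * ρ' l ≤ a * ρ l := mul_le_mul_of_nonneg_left (hle l) ha.le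
    linarith
  refine ⟨fun v ρ h01 hsum hcons _ => tighten v ρ h01 hsum hcons, Set.Subset.antisymm ?_ ?_⟩
  · rintro c ⟨v, ρ, h01, hsum, hcons, hbounds, hc⟩
    obtain ⟨ρ', h01', -, hsum', hcons'⟩ := tighten v ρ h01 hsum hcons
    exact ⟨v, ρ', h01', hsum', hcons', hbounds, hc⟩
  · rintro c ⟨v, ρ, h01, hsum, hcons, hbounds, hc⟩
    exact ⟨v, ρ, h01, hsum.ge, hcons, hbounds, hc⟩
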